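/- arXiv:2303.01372 — 2 statements merged into one kernel-verified Lean document; each statement's English description precedes it below -/
import Mathlib

section
/- Existence and uniqueness of the self-induced regularization parameter: let μ be a probability measure on ℝ whose support is a compact subset of (0,∞) and let γ > 0. Then (i) for every λ > 0 there exists a unique κ > 0 such that κ·(1 − γ·∫ σ/(σ+κ) dμ(σ)) = λ, and this κ satisfies κ ≥ λ; (ii) if γ > 1, there exists a unique κ₀ > 0 such that γ·∫ σ/(σ+κ₀) dμ(σ) = 1. -/
open MeasureTheory

lemma integrable_div_add_of_Icc {μ : Measure ℝ} [IsProbabilityMeasure μ] {a b : ℝ} (ha : 0 < a)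
    (hμ : ∀ᵐ s ∂μ, s ∈ Set.Icc a b) {κ : ℝ} (hκ : 0 ≤ κ) :
    Integrable (fun s : ℝ => s / (s + κ)) μ := by
  refine Integrable.of_bound (C := 1)
    (measurable_id.div (measurable_id.add_const κ)).aestronglyMeasurable ?_
  filter_upwards [hμ] with s hs
  have hs0 : 0 < s := ha.trans_le hs.1
  rw [Real.norm_of_nonneg (by positivity), div_le_one (by positivity)]
  linarith

lemma integral_div_add_nonneg {μ : Measure ℝ} {a b : ℝ} (ha : 0 < a)
    (hμ : ∀ᵐ s ∂μ, s ∈ Set.Icc a b) {κ : ℝ} (hκ : 0 ≤ κ) :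
    0 ≤ ∫ s, s / (s + κ) ∂μ := by
  refine integral_nonneg_of_ae ?_
  filter_upwards [hμ] with s hs
  have hs0 : 0 < s := ha.trans_le hs.1
  exact div_nonneg hs0.le (by positivity)

lemma integral_div_add_le {μ : Measure ℝ} [IsProbabilityMeasure μ] {a b : ℝ} (ha : 0 < a)
    (hμ : ∀ᵐ s ∂μ, s ∈ Set.Icc a b) {κ : ℝ} (hκ : 0 < κ) :
    ∫ s, s / (s + κ) ∂μ ≤ b / κ := by
  have h : ∫ s, s / (s + κ) ∂μ ≤ ∫ _, b / κ ∂μ := by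
    refine integral_mono_ae (integrable_div_add_of_Icc ha hμ hκ.le) (integrable_const _) ?_
    filter_upwards [hμ] with s hs
    have hs0 : 0 < s := ha.trans_le hs.1
    have hb0 : 0 < b := hs0.trans_le hs.2
    exact div_le_div₀ hb0.le hs.2 hκ (by linarith)
  simpa using h

lemma integral_div_add_strictAntiOn {μ : Measure ℝ} [IsProbabilityMeasure μ] {a b : ℝ}
    (ha : 0 < a) (hμ : ∀ᵐ s ∂μ, s ∈ Set.Icc a b) :
    StrictAntiOn (fun κ : ℝ => ∫ s, s / (s + κ) ∂μ) (Set.Ici 0) := by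
  intro κ (hκ : 0 ≤ κ) κ' (hκ' : 0 ≤ κ') hlt
  have h : ∀ᵐ s ∂μ, 0 < s / (s + κ) - s / (s + κ') := by
    filter_upwards [hμ] with s hs
    have hs0 : 0 < s := ha.trans_le hs.1
    exact sub_pos.2 (div_lt_div_of_pos_left hs0 (by positivity) (by linarith))
  have hi := integrable_div_add_of_Icc ha hμ hκ
  have hi' := integrable_div_add_of_Icc ha hμ hκ'
  change ∫ s, s / (s + κ') ∂μ < ∫ s, s / (s + κ) ∂μ
  have hsupp : Function.support (fun s : ℝ => s / (s + κ) - s / (s + κ')) ∈ ae μ :=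
    h.mono fun _ hs => hs.ne'
  rw [← sub_pos, ← integral_sub hi hi',
    integral_pos_iff_support_of_nonneg_ae (h.mono fun _ hs => hs.le) (hi.sub hi'),
    measure_congr (Filter.eventuallyEq_univ.2 hsupp), measure_univ]
  exact one_pos

lemma continuousOn_integral_div_add {μ : Measure ℝ} [IsProbabilityMeasure μ] {a b : ℝ}
    (ha : 0 < a) (hμ : ∀ᵐ s ∂μ, s ∈ Set.Icc a b) :
    ContinuousOn (fun κ : ℝ => ∫ s, s / (s + κ) ∂μ) (Set.Ici 0) := by
  refine continuousOn_of_dominated (bound := fun _ => 1)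
    (fun κ _ => (measurable_id.div (measurable_id.add_const κ)).aestronglyMeasurable) ?_
    (integrable_const _) ?_
  · intro κ (hκ : 0 ≤ κ)
    filter_upwards [hμ] with s hs
    have hs0 : 0 < s := ha.trans_le hs.1
    rw [Real.norm_of_nonneg (by positivity), div_le_one (by positivity)]
    linarith
  · filter_upwards [hμ] with s hs
    have hs0 : 0 < s := ha.trans_le hs.1
    refine continuousOn_const.div (by fun_prop) ?_
    intro κ (hκ : 0 ≤ κ)
    positivity

lemma integral_div_add_zero {μ : Measure ℝ} [IsProbabilityMeasure μ] {a b : ℝ}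
    (ha : 0 < a) (hμ : ∀ᵐ s ∂μ, s ∈ Set.Icc a b) :
    ∫ s, s / (s + 0) ∂μ = 1 := by
  have h : ∫ s, s / (s + 0) ∂μ = ∫ _, (1 : ℝ) ∂μ := by
    refine integral_congr_ae ?_
    filter_upwards [hμ] with s hs
    rw [add_zero, div_self (ha.trans_le hs.1).ne']
  simpa using h

/-- Existence and uniqueness of the self-induced regularization parameter: for a probability
measure `μ` on `ℝ` with compact support contained in `(0,∞)` and `γ > 0`:
(i) for every `λ > 0` there is a unique `κ > 0` with `κ·(1 − γ·∫ σ/(σ+κ) dμ) = λ`, and any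
such `κ` satisfies `κ ≥ λ`; (ii) if `γ > 1`, there is a unique `κ₀ > 0` with
`γ·∫ σ/(σ+κ₀) dμ = 1`. -/
theorem self_induced_regularization_exists_unique
    (μ : Measure ℝ) [IsProbabilityMeasure μ]
    (hsupp : ∃ a b : ℝ, 0 < a ∧ a ≤ b ∧ μ (Set.Icc a b)ᶜ = 0)
    (γ : ℝ) (hγ : 0 < γ) :
    (∀ lam : ℝ, 0 < lam →
      (∃! κ : ℝ, 0 < κ ∧ κ * (1 - γ * ∫ s, s / (s + κ) ∂μ) = lam) ∧
      (∀ κ : ℝ, 0 < κ → κ * (1 - γ * ∫ s, s / (s + κ) ∂μ) = lam → lam ≤ κ)) ∧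
    (1 < γ → ∃! κ₀ : ℝ, 0 < κ₀ ∧ γ * ∫ s, s / (s + κ₀) ∂μ = 1) := by
  obtain ⟨a, b, ha, hab, hc⟩ := hsupp
  have hμ : ∀ᵐ s ∂μ, s ∈ Set.Icc a b := mem_ae_iff.2 hc
  have hb : 0 < b := ha.trans_le hab
  have hanti := integral_div_add_strictAntiOn ha hμ
  have hcont := continuousOn_integral_div_add ha hμ
  have hnonneg := fun κ (hκ : 0 ≤ κ) => integral_div_add_nonneg ha hμ hκ
  have hle := fun κ (hκ : 0 < κ) => integral_div_add_le ha hμ hκ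
  have hzero := integral_div_add_zero ha hμ
  set F : ℝ → ℝ := fun κ => ∫ s, s / (s + κ) ∂μ
  change ∀ κ, 0 ≤ κ → 0 ≤ F κ at hnonneg
  change ∀ κ, 0 < κ → F κ ≤ b / κ at hle
  change F 0 = 1 at hzero
  change (∀ lam : ℝ, 0 < lam → (∃! κ : ℝ, 0 < κ ∧ κ * (1 - γ * F κ) = lam) ∧
    (∀ κ : ℝ, 0 < κ → κ * (1 - γ * F κ) = lam → lam ≤ κ)) ∧
    (1 < γ → ∃! κ₀ : ℝ, 0 < κ₀ ∧ γ * F κ₀ = 1)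
  clear_value F
  refine ⟨fun lam hlam => ⟨?_, fun κ hκ h => ?_⟩, fun hγ1 => ?_⟩
  · refine existsUnique_of_exists_of_unique ?_ ?_
    · set K := lam + γ * b
      have hK : 0 < K := by positivity
      have hc : ContinuousOn (fun κ => κ * (1 - γ * F κ)) (Set.Icc 0 K) :=
        continuousOn_id.mul
          (continuousOn_const.sub (continuousOn_const.mul (hcont.mono Set.Icc_subset_Ici_self)))
      have hKF : F K * K ≤ b := (le_div_iff₀ hK).1 (hle K hK)
      have hmem : lam ∈ Set.Icc (0 * (1 - γ * F 0)) (K * (1 - γ * F K)) := by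
        refine ⟨by simpa using hlam.le, ?_⟩
        have := mul_le_mul_of_nonneg_left hKF hγ.le
        linarith [show K * (1 - γ * F K) = lam + γ * b - γ * (F K * K) by ring]
      obtain ⟨κ, hκ, h⟩ := intermediate_value_Icc hK.le hc hmem
      refine ⟨κ, hκ.1.lt_of_ne ?_, h⟩
      rintro rfl
      simp [hlam.ne] at h
    · have key : ∀ x y : ℝ, 0 < x → x < y → x * (1 - γ * F x) = lam →
          y * (1 - γ * F y) = lam → False := by
        intro x y hx hxy h₁ h₂
        have hy : 0 < y := hx.trans hxy
        have hpos : 0 < 1 - γ * F x := pos_of_mul_pos_right (h₁ ▸ hlam) hx.le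
        have h₃ : 1 - γ * F x ≤ 1 - γ * F y :=
          sub_le_sub_left (mul_le_mul_of_nonneg_left (hanti hx.le hy.le hxy).le hγ.le) 1
        have h₄ := mul_lt_mul hxy h₃ hpos hy.le
        linarith
      rintro x y ⟨hx, h₁⟩ ⟨hy, h₂⟩
      rcases lt_trichotomy x y with h | h | h
      · exact (key x y hx h h₁ h₂).elim
      · exact h
      · exact (key y x hy h h₂ h₁).elim
  · have := mul_nonneg hκ.le (mul_nonneg hγ.le (hnonneg κ hκ.le))
    linarith
  · refine existsUnique_of_exists_of_unique ?_ ?_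
    · have hK : 0 < γ * b := by positivity
      have hc : ContinuousOn (fun κ => γ * F κ) (Set.Icc 0 (γ * b)) :=
        continuousOn_const.mul (hcont.mono Set.Icc_subset_Ici_self)
      have hKF : F (γ * b) * (γ * b) ≤ b := (le_div_iff₀ hK).1 (hle _ hK)
      have hmem : (1 : ℝ) ∈ Set.Icc (γ * F (γ * b)) (γ * F 0) := by
        refine ⟨?_, by rw [hzero]; linarith⟩
        refine le_of_mul_le_mul_right ?_ hb
        linarith
      obtain ⟨κ, hκ, h⟩ := intermediate_value_Icc' hK.le hc hmem
      refine ⟨κ, hκ.1.lt_of_ne ?_, h⟩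
      rintro rfl
      simp only [hzero] at h
      linarith
    · rintro x y ⟨hx, h₁⟩ ⟨hy, h₂⟩
      exact hanti.injOn hx.le hy.le (mul_left_cancel₀ hγ.ne' (h₁.trans h₂.symm))
end

section
/- Leave-one-out trace identity: let x₁, …, x_n ∈ ℝ^d, let X ∈ ℝ^{n×d} be the matrix with rows x₁ᵀ, …, x_nᵀ, and let λ > 0. Then tr[XᵀX (XᵀX + nλI)⁻¹] = n − Σ_{i=1}^n 1/(1 + xᵢᵀ(Σ_{j≠i} xⱼxⱼᵀ + nλI)⁻¹ xᵢ). -/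
open Matrix

/-- Scalar form of the Sherman–Morrison formula. -/
theorem dotProduct_inv_add_vecMulVec_mulVec {m K : Type*} [Fintype m] [DecidableEq m] [Field K]
    {A : Matrix m m K} {u v : m → K} (hA : IsUnit A) (hB : IsUnit (A + vecMulVec u v))
    (h : 1 + v ⬝ᵥ (A⁻¹ *ᵥ u) ≠ 0) :
    v ⬝ᵥ ((A + vecMulVec u v)⁻¹ *ᵥ u) = 1 - 1 / (1 + v ⬝ᵥ (A⁻¹ *ᵥ u)) := by
  rw [Matrix.isUnit_iff_isUnit_det] at hA hB
  have hw : (A + vecMulVec u v) *ᵥ (A⁻¹ *ᵥ u) = (1 + v ⬝ᵥ (A⁻¹ *ᵥ u)) • u := by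
    rw [add_mulVec, mulVec_mulVec, mul_nonsing_inv _ hA, one_mulVec, vecMulVec_mulVec,
      op_smul_eq_smul, add_smul, one_smul]
  have hinv : A⁻¹ *ᵥ u = (1 + v ⬝ᵥ (A⁻¹ *ᵥ u)) • ((A + vecMulVec u v)⁻¹ *ᵥ u) := by
    rw [← mulVec_smul, ← hw, mulVec_mulVec, nonsing_inv_mul _ hB, one_mulVec]
  have hdot := congrArg (v ⬝ᵥ ·) hinv
  simp only [dotProduct_smul, smul_eq_mul] at hdot
  rw [eq_sub_iff_add_eq]
  field_simp
  linear_combination -hdot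

theorem transpose_mul_self_eq_sum_vecMulVec {m k R : Type*} [Fintype m] [CommSemiring R]
    (X : Matrix m k R) : Xᵀ * X = ∑ i, vecMulVec (X i) (X i) := by
  ext a b
  simp [Matrix.mul_apply, Matrix.sum_apply, vecMulVec_apply]

theorem posDef_sum_vecMulVec_self_add_smul_one {ι m : Type*} [Fintype m] [DecidableEq m]
    (s : Finset ι) (x : ι → m → ℝ) {c : ℝ} (hc : 0 < c) :
    (∑ j ∈ s, vecMulVec (x j) (x j) + c • (1 : Matrix m m ℝ)).PosDef :=
  PosDef.posSemidef_add
    (posSemidef_sum s fun j _ => by simpa using posSemidef_vecMulVec_self_star (x j))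
    (PosDef.one.smul hc)

/-- Leave-one-out trace identity: for `x₁, …, x_n ∈ ℝ^d`, the matrix `X` with rows `xᵢᵀ`,
and `λ > 0`,
`tr[XᵀX (XᵀX + nλI)⁻¹] = n − Σᵢ 1/(1 + xᵢᵀ(Σ_{j≠i} xⱼxⱼᵀ + nλI)⁻¹ xᵢ)`. -/
theorem leave_one_out_trace_identity
    {n d : ℕ} (x : Fin n → Fin d → ℝ) (lam : ℝ) (hlam : 0 < lam) :
    let X : Matrix (Fin n) (Fin d) ℝ := Matrix.of fun i j => x i j
    Matrix.trace (Xᵀ * X * (Xᵀ * X + ((n : ℝ) * lam) • 1)⁻¹)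
      = n - ∑ i : Fin n, 1 / (1 + x i ⬝ᵥ
          ((∑ j ∈ Finset.univ.erase i, Matrix.vecMulVec (x j) (x j)
              + ((n : ℝ) * lam) • 1)⁻¹ *ᵥ x i)) := by
  intro X
  have hX : Xᵀ * X = ∑ i, vecMulVec (x i) (x i) := transpose_mul_self_eq_sum_vecMulVec X
  have hn : (n : ℝ) = ∑ _i : Fin n, (1 : ℝ) := by simp
  rw [hX, Finset.sum_mul, trace_sum]
  conv_rhs => rw [sub_eq_add_neg]; enter [1]; rw [hn]
  rw [← sub_eq_add_neg, ← Finset.sum_sub_distrib]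
  refine Finset.sum_congr rfl fun i _ => ?_
  have hc : 0 < (n : ℝ) * lam := mul_pos (Nat.cast_pos.mpr i.pos) hlam
  have hA := posDef_sum_vecMulVec_self_add_smul_one (Finset.univ.erase i) x hc
  have hB := posDef_sum_vecMulVec_self_add_smul_one Finset.univ x hc
  have hAB : ∑ j, vecMulVec (x j) (x j) + ((n : ℝ) * lam) • (1 : Matrix (Fin d) (Fin d) ℝ)
      = (∑ j ∈ Finset.univ.erase i, vecMulVec (x j) (x j) + ((n : ℝ) * lam) • 1)
        + vecMulVec (x i) (x i) := by
    rw [← Finset.sum_erase_add _ _ (Finset.mem_univ i), add_right_comm]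
  have hnonneg := hA.inv.posSemidef.dotProduct_mulVec_nonneg (x i)
  rw [star_trivial] at hnonneg
  rw [vecMulVec_mul, trace_vecMulVec, dotProduct_comm, ← dotProduct_mulVec, hAB]
  exact dotProduct_inv_add_vecMulVec_mulVec hA.isUnit (hAB ▸ hB.isUnit) (by positivity)
end
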